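/- arXiv:0904.4666 — 2 statements merged into one kernel-verified Lean document; each statement's English description precedes it below -/
import Mathlib

section
/- Every complete orthomodular lattice L is Boolean saturated: for every element a ∈ L, the set {z ∈ Z(L) : a ≤ z} of central elements above a has a least element (and hence the modal operator ◇a = Min{z ∈ Z(L) : a ≤ z} is well defined on all of L). -/
/-! Basic notions: orthomodular lattices, central elements, Boolean saturation,
modal extensions and possibility spaces. -/

/-- An orthomodular lattice: a bounded lattice with an involution `neg`
satisfying `x ⊓ neg x = ⊥` and the orthomodular law. -/
class OML (α : Type u) extends Lattice α, BoundedOrder α where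
  neg : α → α
  neg_neg : ∀ x : α, neg (neg x) = x
  neg_sup : ∀ x y : α, neg (x ⊔ y) = neg x ⊓ neg y
  inf_neg : ∀ x : α, x ⊓ neg x = ⊥
  orthomodular : ∀ x y : α, x ⊔ (neg x ⊓ (x ⊔ y)) = x ⊔ y

namespace OML

variable {α : Type u} [OML α]

/-- `(a,b,c)D` -/
def D (a b c : α) : Prop := (a ⊔ b) ⊓ c = (a ⊓ c) ⊔ (b ⊓ c)

/-- `(a,b,c)D*` -/
def Dstar (a b c : α) : Prop := (a ⊓ b) ⊔ c = (a ⊔ c) ⊓ (b ⊔ c)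

/-- A central element: complemented and all permuted distributivity
conditions hold. -/
def IsCentral (z : α) : Prop :=
  (∃ c : α, z ⊓ c = ⊥ ∧ z ⊔ c = ⊤) ∧
    ∀ a b : α, D a b z ∧ D a z b ∧ D z a b ∧ Dstar a b z ∧ Dstar a z b ∧ Dstar z a b

end OML

/-- `dia` is the possibility operator: `dia a` is the least central element above `a`. -/
def IsDiamond {α : Type u} [OML α] (dia : α → α) : Prop :=
  ∀ a : α, IsLeast {z : α | OML.IsCentral z ∧ a ≤ z} (dia a)

/-- A Boolean saturated orthomodular lattice: every `{z ∈ Z(L) : a ≤ z}` has a minimum. -/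
def BooleanSaturated (α : Type u) [OML α] : Prop :=
  ∀ a : α, ∃ m : α, IsLeast {z : α | OML.IsCentral z ∧ a ≤ z} m

/-- A Boolean sublattice: a sublattice containing `⊥, ⊤`, closed under `neg`,
and distributive. -/
structure IsBooleanSub {α : Type u} [OML α] (S : Set α) : Prop where
  bot_mem : (⊥ : α) ∈ S
  top_mem : (⊤ : α) ∈ S
  inf_mem : ∀ x ∈ S, ∀ y ∈ S, x ⊓ y ∈ S
  sup_mem : ∀ x ∈ S, ∀ y ∈ S, x ⊔ y ∈ S
  neg_mem : ∀ x ∈ S, OML.neg x ∈ S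
  distrib : ∀ x ∈ S, ∀ y ∈ S, ∀ z ∈ S, x ⊓ (y ⊔ z) = (x ⊓ y) ⊔ (x ⊓ z)

/-- A Boolean homomorphism into the two-element Boolean algebra `Bool`,
defined on the subset `S`. -/
def IsBoolHomOn {α : Type u} [OML α] (S : Set α) (v : α → Bool) : Prop :=
  v ⊥ = false ∧ v ⊤ = true ∧
    (∀ x ∈ S, ∀ y ∈ S, v (x ⊓ y) = (v x && v y)) ∧
    (∀ x ∈ S, ∀ y ∈ S, v (x ⊔ y) = (v x || v y)) ∧
    (∀ x ∈ S, v (OML.neg x) = !(v x))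

/-- Membership in the sublattice generated by `X`. -/
inductive GenSub {α : Type u} [OML α] (X : Set α) : α → Prop
  | base : ∀ x ∈ X, GenSub X x
  | inf : ∀ x y, GenSub X x → GenSub X y → GenSub X (x ⊓ y)
  | sup : ∀ x y, GenSub X x → GenSub X y → GenSub X (x ⊔ y)

/-- The embedding of a modal extension: injective and preserving `⊓, ⊔, neg, ⊥, ⊤`. -/
def IsOMLEmbedding {α : Type u} {β : Type v} [OML α] [OML β] (e : α → β) : Prop :=
  Function.Injective e ∧ e ⊥ = ⊥ ∧ e ⊤ = ⊤ ∧
    (∀ x y : α, e (x ⊓ y) = e x ⊓ e y) ∧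
    (∀ x y : α, e (x ⊔ y) = e x ⊔ e y) ∧
    (∀ x : α, e (OML.neg x) = OML.neg (e x))

/-- The possibility space `◇L`: the sublattice of `L^◇` generated by `{◇p : p ∈ L}`. -/
def PossSpace {α : Type u} {β : Type v} [OML α] [OML β] (e : α → β) (dia : β → β) : Set β :=
  {x : β | GenSub (Set.range fun p : α => dia (e p)) x}

/-- A global valuation: a compatible family of Boolean homomorphisms into `2`,
indexed by the Boolean sublattices. -/
def HasGlobalValuation (α : Type u) [OML α] : Prop :=
  ∃ v : Set α → α → Bool,
    (∀ W : Set α, IsBooleanSub W → IsBoolHomOn W (v W)) ∧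
    (∀ W W' : Set α, IsBooleanSub W → IsBooleanSub W' → ∀ x ∈ W ∩ W', v W x = v W' x)
namespace OML

variable {α : Type u} [OML α]

theorem neg_le_neg {x y : α} (h : x ≤ y) : neg y ≤ neg x := by
  rw [← sup_eq_right.mpr h, neg_sup]
  exact inf_le_left

theorem neg_inf (x y : α) : neg (x ⊓ y) = neg x ⊔ neg y := by
  rw [← neg_neg (neg x ⊔ neg y), neg_sup, neg_neg, neg_neg]

theorem sup_neg (x : α) : x ⊔ neg x = ⊤ := by
  apply top_unique
  have h := orthomodular x ⊤
  simp only [le_top, sup_of_le_right, inf_of_le_left] at h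
  exact h.ge

theorem sup_neg_inf_of_le {x y : α} (h : x ≤ y) : x ⊔ (y ⊓ neg x) = y := by
  have := orthomodular x y
  rwa [sup_eq_right.mpr h, inf_comm] at this

theorem eq_of_le_of_inf_neg_eq_bot {x y : α} (h : x ≤ y) (hb : y ⊓ neg x = ⊥) : x = y := by
  rw [← sup_neg_inf_of_le h, hb, sup_bot_eq]

/-- `z` commutes with every element. -/
def CommutesAll (z : α) : Prop := ∀ x : α, x = (x ⊓ z) ⊔ (x ⊓ neg z)

theorem CommutesAll.neg {z : α} (h : CommutesAll z) : CommutesAll (neg z) := fun x => by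
  rw [neg_neg, sup_comm]
  exact h x

theorem sup_inf_eq_left {z u v : α} (hu : u ≤ z) (hv : v ≤ neg z) : (u ⊔ v) ⊓ z = u := by
  refine (eq_of_le_of_inf_neg_eq_bot (le_inf le_sup_left hu) (bot_unique ?_)).symm
  have hz : z ≤ neg v := by simpa [neg_neg] using neg_le_neg hv
  rw [← inf_neg (u ⊔ v), inf_assoc, neg_sup]
  exact inf_le_inf_left _ (le_inf inf_le_right (inf_le_left.trans hz))

theorem CommutesAll.distrib {z : α} (h : CommutesAll z) (a b : α) : D a b z := by
  have hab : a ⊔ b = (a ⊓ z ⊔ b ⊓ z) ⊔ (a ⊓ OML.neg z ⊔ b ⊓ OML.neg z) := by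
    rw [sup_sup_sup_comm, ← h a, ← h b]
  rw [D, hab]
  exact sup_inf_eq_left (sup_le inf_le_right inf_le_right) (sup_le inf_le_right inf_le_right)

theorem CommutesAll.distrib_middle {z : α} (h : CommutesAll z) (a b : α) : D a z b := by
  refine le_antisymm ?_ (sup_le (inf_le_inf_right _ le_sup_left) (inf_le_inf_right _ le_sup_right))
  rw [h ((a ⊔ z) ⊓ b)]
  refine sup_le (le_sup_of_le_right (le_inf inf_le_right (inf_le_left.trans inf_le_right)))
    (le_sup_of_le_left (le_inf ?_ (inf_le_left.trans inf_le_right)))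
  have hd : (a ⊔ z) ⊓ OML.neg z = a ⊓ OML.neg z ⊔ z ⊓ OML.neg z := h.neg.distrib a z
  rw [inf_neg, sup_bot_eq] at hd
  exact ((inf_le_inf_right _ inf_le_left).trans hd.le).trans inf_le_left

theorem D.dstar {a b c : α} (h : D (neg a) (neg b) (neg c)) : Dstar a b c := by
  have := congrArg OML.neg h
  simpa only [Dstar, neg_sup, neg_inf, neg_neg] using this

theorem D.symm {a b c : α} (h : D a b c) : D b a c := by
  rwa [D, sup_comm, sup_comm (b ⊓ c)]

theorem CommutesAll.isCentral {z : α} (h : CommutesAll z) : IsCentral z :=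
  ⟨⟨OML.neg z, inf_neg z, sup_neg z⟩, fun a b =>
    ⟨h.distrib a b, h.distrib_middle a b, (h.distrib_middle a b).symm,
      (h.neg.distrib _ _).dstar, (h.neg.distrib_middle _ _).dstar,
      (h.neg.distrib_middle _ _).symm.dstar⟩⟩

theorem IsCentral.commutesAll {z : α} (h : IsCentral z) : CommutesAll z := fun x => by
  have hd : (z ⊔ neg z) ⊓ x = z ⊓ x ⊔ neg z ⊓ x := (h.2 (neg z) x).2.2.1
  rwa [sup_neg, top_inf_eq, inf_comm z, inf_comm (neg z)] at hd

theorem CommutesAll.of_isGLB {S : Set α} {m : α} (hS : ∀ z ∈ S, CommutesAll z)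
    (hm : IsGLB S m) : CommutesAll m := fun x => by
  refine le_antisymm ?_ (sup_le inf_le_left inf_le_left)
  have hw : x ⊓ OML.neg (x ⊓ OML.neg m) ≤ m := hm.2 fun z hz => by
    rw [hS z hz (x ⊓ OML.neg (x ⊓ OML.neg m))]
    refine sup_le inf_le_right (le_trans ?_ bot_le)
    rw [← inf_neg (x ⊓ OML.neg m)]
    exact le_inf (le_inf (inf_le_left.trans inf_le_left)
      (inf_le_right.trans (neg_le_neg (hm.1 hz)))) (inf_le_left.trans inf_le_right)
  calc x = x ⊓ OML.neg m ⊔ x ⊓ OML.neg (x ⊓ OML.neg m) := (sup_neg_inf_of_le inf_le_left).symm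
    _ ≤ x ⊓ m ⊔ x ⊓ OML.neg m :=
      sup_le le_sup_right (le_sup_of_le_left (le_inf inf_le_left hw))

end OML

/-- Every complete orthomodular lattice is Boolean saturated:
for each `a`, the set of central elements above `a` has a least element. -/
theorem complete_oml_boolean_saturated {α : Type u} [OML α]
    (hsup : ∀ S : Set α, ∃ s : α, IsLUB S s)
    (hinf : ∀ S : Set α, ∃ s : α, IsGLB S s) :
    BooleanSaturated α := by
  intro a
  obtain ⟨m, hm⟩ := hinf {z : α | OML.IsCentral z ∧ a ≤ z}
  exact ⟨m, ⟨(OML.CommutesAll.of_isGLB (fun z hz => hz.1.commutesAll) hm).isCentral,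
    hm.2 fun z hz => hz.2⟩, hm.1⟩
end

section
/- Let L be a Boolean saturated orthomodular lattice, define ◇a = Min{z ∈ Z(L) : a ≤ z} and □x = ¬◇¬x. Then □ satisfies the following equations for all x, y ∈ L: (S1) □x ≤ x; (S2) □1 = 1; (S3) □□x = □x; (S4) □(x ∧ y) = □x ∧ □y; (S5) y = (y ∧ □x) ∨ (y ∧ ¬□x); (S6) □(x ∨ □y) = □x ∨ □y; (S7) □(¬x ∨ (y ∧ x)) ≤ ¬□x ∨ □y. -/
namespace OML

variable {α : Type u} [OML α]

theorem neg_le_comm {x y : α} (h : neg x ≤ y) : neg y ≤ x := by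
  simpa only [neg_neg] using neg_le_neg h

theorem neg_bot : neg (⊥ : α) = ⊤ := by
  refine top_le_iff.mp ?_
  rw [← neg_neg (⊤ : α)]
  exact neg_le_neg bot_le

/-- The Sasaki projection of `x ⊓ y` onto `x` is `x ⊓ y` itself. -/
theorem inf_neg_sup_inf (x y : α) : x ⊓ (neg x ⊔ (x ⊓ y)) = x ⊓ y := by
  have h := congrArg neg (orthomodular (neg x) (neg y))
  simpa only [neg_sup, neg_inf, neg_neg] using h

theorem D.neg {a b c : α} (h : D a b c) : Dstar (neg a) (neg b) (neg c) := by
  have h' := congrArg OML.neg h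
  simpa only [Dstar, neg_sup, neg_inf] using h'

theorem Dstar.neg {a b c : α} (h : Dstar a b c) : D (neg a) (neg b) (neg c) := by
  have h' := congrArg OML.neg h
  simpa only [D, neg_sup, neg_inf] using h'

namespace IsCentral

variable {z w : α}

theorem sup_inf (hz : IsCentral z) (a b : α) : (a ⊔ b) ⊓ z = (a ⊓ z) ⊔ (b ⊓ z) :=
  (hz.2 a b).1

theorem sup_self_inf (hz : IsCentral z) (a b : α) : (a ⊔ z) ⊓ b = (a ⊓ b) ⊔ (z ⊓ b) :=
  (hz.2 a b).2.1

theorem inf_sup (hz : IsCentral z) (a b : α) : (a ⊓ b) ⊔ z = (a ⊔ z) ⊓ (b ⊔ z) :=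
  (hz.2 a b).2.2.2.1

theorem inf_self_sup (hz : IsCentral z) (a b : α) : (a ⊓ z) ⊔ b = (a ⊔ b) ⊓ (z ⊔ b) :=
  (hz.2 a b).2.2.2.2.1

/-- Centrality needs only one instance of each pair of distributive laws that differ by
commutativity, the negation being a complement. -/
theorem of_distrib (h₁ : ∀ a b, D a b z) (h₂ : ∀ a b, D a z b)
    (h₃ : ∀ a b, Dstar a b z) (h₄ : ∀ a b, Dstar a z b) : IsCentral z := by
  refine ⟨⟨OML.neg z, inf_neg z, sup_neg z⟩, fun a b =>
    ⟨h₁ a b, h₂ a b, ?_, h₃ a b, h₄ a b, ?_⟩⟩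
  · have h := h₂ a b
    unfold D at h ⊢
    rw [sup_comm, h, sup_comm]
  · have h := h₄ a b
    unfold Dstar at h ⊢
    rw [inf_comm, h, inf_comm]

theorem neg (hz : IsCentral z) : IsCentral (neg z) := by
  refine of_distrib (fun a b => ?_) (fun a b => ?_) (fun a b => ?_) (fun a b => ?_)
  · simpa only [neg_neg] using Dstar.neg (hz.inf_sup (OML.neg a) (OML.neg b))
  · simpa only [neg_neg] using Dstar.neg (hz.inf_self_sup (OML.neg a) (OML.neg b))
  · simpa only [neg_neg] using D.neg (hz.sup_inf (OML.neg a) (OML.neg b))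
  · simpa only [neg_neg] using D.neg (hz.sup_self_inf (OML.neg a) (OML.neg b))

theorem inf (hz : IsCentral z) (hw : IsCentral w) : IsCentral (z ⊓ w) := by
  have sup_zw (a : α) : a ⊔ (z ⊓ w) = (a ⊔ z) ⊓ (a ⊔ w) := by
    rw [sup_comm, hw.inf_self_sup, sup_comm z, sup_comm w]
  refine of_distrib (fun a b => ?_) (fun a b => ?_) (fun a b => ?_) (fun a b => ?_)
  · unfold D
    rw [← inf_assoc, hz.sup_inf, hw.sup_inf, inf_assoc, inf_assoc]
  · unfold D
    refine le_antisymm ?_ (sup_le (inf_le_inf_right b le_sup_left)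
      (inf_le_inf_right b le_sup_right))
    rw [sup_zw, inf_assoc, hw.sup_self_inf, hz.sup_self_inf]
    refine sup_le ?_ ?_
    · rw [← hw.sup_self_inf, ← inf_assoc, inf_sup_self]
      exact le_sup_left
    · rw [inf_comm z, hz.sup_inf, inf_comm _ z, inf_comm _ z, inf_assoc]
      exact sup_le_sup_right inf_le_right _
  · unfold Dstar
    rw [sup_zw, hz.inf_sup, hw.inf_sup, sup_zw, sup_zw, inf_inf_inf_comm]
  · unfold Dstar
    rw [← inf_assoc, hw.inf_self_sup, hz.inf_self_sup, hw.inf_self_sup, inf_assoc]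

theorem sup (hz : IsCentral z) (hw : IsCentral w) : IsCentral (z ⊔ w) := by
  simpa only [neg_inf, neg_neg] using (hz.neg.inf hw.neg).neg

theorem eq_inf_sup_inf_neg (hz : IsCentral z) (a : α) :
    a = (a ⊓ z) ⊔ (a ⊓ OML.neg z) := by
  rw [inf_comm a, inf_comm a, sup_comm, ← hz.sup_self_inf, sup_comm, sup_neg, top_inf_eq]

end IsCentral

theorem isCentral_top : IsCentral (⊤ : α) :=
  IsCentral.of_distrib (fun _ _ => by simp [D]) (fun _ _ => by simp [D])
    (fun _ _ => by simp [Dstar]) (fun _ _ => by simp [Dstar])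

end OML

/-- `¬◇¬x` is the greatest central element below `x`. -/
theorem IsDiamond.isGreatest_neg {α : Type u} [OML α] {dia : α → α} (hdia : IsDiamond dia)
    (x : α) : IsGreatest {z : α | OML.IsCentral z ∧ z ≤ x} (OML.neg (dia (OML.neg x))) := by
  obtain ⟨⟨hc, hle⟩, hmin⟩ := hdia (OML.neg x)
  refine ⟨⟨hc.neg, OML.neg_le_comm hle⟩, fun z ⟨hz, hzx⟩ => ?_⟩
  rw [← OML.neg_neg z]
  exact OML.neg_le_neg (hmin ⟨hz.neg, OML.neg_le_neg hzx⟩)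

/-- In a Boolean saturated orthomodular lattice, the necessity
operator `□x = ¬◇¬x` satisfies the equations S1–S7. -/
theorem box_satisfies_S1_to_S7 {α : Type u} [OML α]
    (dia : α → α) (hdia : IsDiamond dia)
    (box : α → α) (hbox : ∀ x : α, box x = OML.neg (dia (OML.neg x)))
    (x y : α) :
    box x ≤ x ∧                                             -- S1
    box (⊤ : α) = ⊤ ∧                                       -- S2
    box (box x) = box x ∧                                   -- S3
    box (x ⊓ y) = box x ⊓ box y ∧                           -- S4
    y = (y ⊓ box x) ⊔ (y ⊓ OML.neg (box x)) ∧               -- S5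
    box (x ⊔ box y) = box x ⊔ box y ∧                       -- S6
    box (OML.neg x ⊔ (y ⊓ x)) ≤ OML.neg (box x) ⊔ box y     -- S7
    := by
  have central (a : α) : OML.IsCentral (box a) := hbox a ▸ (hdia.isGreatest_neg a).1.1
  have box_le (a : α) : box a ≤ a := hbox a ▸ (hdia.isGreatest_neg a).1.2
  have le_box {z a : α} (hz : OML.IsCentral z) (h : z ≤ a) : z ≤ box a :=
    hbox a ▸ (hdia.isGreatest_neg a).2 ⟨hz, h⟩
  refine ⟨box_le x, top_le_iff.mp (le_box OML.isCentral_top le_rfl),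
    le_antisymm (box_le _) (le_box (central x) le_rfl), le_antisymm ?_ ?_,
    (central x).eq_inf_sup_inf_neg y, le_antisymm ?_ ?_, ?_⟩
  · exact le_inf (le_box (central _) ((box_le _).trans inf_le_left))
      (le_box (central _) ((box_le _).trans inf_le_right))
  · exact le_box ((central x).inf (central y)) (inf_le_inf (box_le x) (box_le y))
  · rw [(central y).eq_inf_sup_inf_neg (box (x ⊔ box y))]
    refine sup_le (inf_le_right.trans le_sup_right) (le_trans ?_ le_sup_left)
    refine le_box ((central _).inf (central y).neg) ?_
    refine (inf_le_inf_right _ (box_le _)).trans ?_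
    rw [(central y).sup_self_inf, OML.inf_neg, sup_bot_eq]
    exact inf_le_left
  · exact le_box ((central x).sup (central y)) (sup_le_sup_right (box_le x) _)
  · rw [(central x).eq_inf_sup_inf_neg (box (OML.neg x ⊔ (y ⊓ x)))]
    refine sup_le (le_trans ?_ le_sup_right) (inf_le_right.trans le_sup_left)
    refine le_box ((central _).inf (central x)) ?_
    refine (inf_le_inf (box_le _) (box_le x)).trans ?_
    rw [inf_comm, inf_comm y, OML.inf_neg_sup_inf]
    exact inf_le_right
end
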